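/- Let Ω ⊂ ℝ^d be a bounded measurable set with finite positive Lebesgue measure, β > 2, b > 0, and U_ad = {u ∈ L^β(Ω) : ∫_Ω |u|^β dx ≤ b}. Let f : L^β(Ω) → ℝ be Fréchet differentiable at every point, and suppose its derivative map f' is Fréchet differentiable at ū with second derivative f''(ū). Suppose ū ∈ U_ad is a local minimizer of f over U_ad with respect to the L^β(Ω) norm, and λ̄ ≥ 0 satisfies λ̄·ψ(ū) = 0 and f'(ū)h − λ̄ ψ'(ū)h = 0 for every h ∈ L^β(Ω). Let h ∈ L^β(Ω) be any direction for which there exist a sequence (u_n) in U_ad with λ̄·ψ(u_n) = 0 for all n and a sequence t_n > 0 with t_n → 0 such that (u_n − ū)/t_n → h in L^β(Ω). Then f''(ū)[h,h] + λ̄ β(β−1) ∫_Ω |ū(x)|^{β−2} h(x)² dx ≥ 0. -/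

import Mathlib

open MeasureTheory ENNReal

theorem le_taylor_of_deriv_le_affine {F G : ℝ → ℝ} {M : ℝ}
    (hF : ∀ s ∈ Set.Icc (0 : ℝ) 1, HasDerivAt F (G s) s)
    (hG : ∀ s ∈ Set.Icc (0 : ℝ) 1, G s ≤ G 0 + M * s) :
    F 1 ≤ F 0 + G 0 + M / 2 := by
  have hB : ∀ s : ℝ, HasDerivAt (fun s => F 0 + G 0 * s + M * s ^ 2 / 2) (G 0 + M * s) s := by
    intro s
    have := (((hasDerivAt_id s).const_mul (G 0)).const_add (F 0)).add
      ((((hasDerivAt_id s).pow 2).const_mul M).div_const 2)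
    exact this.congr_deriv (by simp; ring)
  have := image_le_of_deriv_right_le_deriv_boundary (f := F) (f' := G) (a := 0) (b := 1)
    (fun s hs => (hF s hs).continuousAt.continuousWithinAt)
    (fun s hs => (hF s ⟨hs.1, hs.2.le⟩).hasDerivWithinAt)
    (B := fun s => F 0 + G 0 * s + M * s ^ 2 / 2) (B' := fun s => G 0 + M * s)
    (by simp)
    (fun s _ => (hB s).continuousAt.continuousWithinAt)
    (fun s _ => (hB s).hasDerivWithinAt)
    (fun s hs => hG s ⟨hs.1, hs.2.le⟩) (x := 1) (by simp)
  simpa using this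

theorem hasDerivAt_abs_rpow_mul_self {q : ℝ} (hq : 0 < q) (y : ℝ) :
    HasDerivAt (fun y : ℝ => |y| ^ q * y) ((q + 1) * |y| ^ q) y := by
  rcases eq_or_ne y 0 with rfl | hy
  · rw [hasDerivAt_iff_tendsto_slope]
    have hcont : Continuous fun y : ℝ => |y| ^ q :=
      continuous_abs.rpow_const fun _ => Or.inr hq.le
    have hlim : Filter.Tendsto (fun y : ℝ => |y| ^ q) (nhdsWithin 0 {0}ᶜ)
        (nhds ((q + 1) * |(0 : ℝ)| ^ q)) := by
      have := (hcont.tendsto 0).mono_left (nhdsWithin_le_nhds (s := {0}ᶜ))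
      simpa [Real.zero_rpow hq.ne'] using this
    refine hlim.congr' ?_
    filter_upwards [self_mem_nhdsWithin] with z hz
    have hz : z ≠ 0 := hz
    simp [slope_def_field, hz]
  · have hy' : |y| ≠ 0 := abs_ne_zero.mpr hy
    have := ((hasDerivAt_abs hy).rpow_const (p := q) (Or.inl hy')).mul (hasDerivAt_id y)
    refine this.congr_deriv ?_
    have h1 : (SignType.sign y : ℝ) * y = |y| := sign_mul_self y
    have h2 : |y| ^ (q - 1) * |y| = |y| ^ q := by
      rw [Real.rpow_sub_one hy']; field_simp
    simp only [id]
    linear_combination (q * |y| ^ (q - 1)) * h1 + q * h2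

theorem abs_add_rpow_le_taylor {β : ℝ} (hβ : 2 < β) (a w : ℝ) :
    |a + w| ^ β ≤ |a| ^ β + β * (|a| ^ (β - 2) * a * w)
      + β * (β - 1) / 2 * ((|a| + |w|) ^ (β - 2) * w ^ 2) := by
  have haff : ∀ s : ℝ, HasDerivAt (fun s : ℝ => a + s * w) w s := fun s => by
    simpa using ((hasDerivAt_id s).mul_const w).const_add a
  have hF : ∀ s : ℝ, HasDerivAt (fun s : ℝ => |a + s * w| ^ β)
      (β * (|a + s * w| ^ (β - 2) * (a + s * w)) * w) s := fun s => by
    have := (hasDerivAt_abs_rpow (a + s * w) (by linarith : 1 < β)).comp s (haff s)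
    exact this.congr_deriv (by ring)
  have hG : ∀ s : ℝ, HasDerivAt
      (fun s : ℝ => β * (|a + s * w| ^ (β - 2) * (a + s * w)) * w)
      (β * ((β - 1) * |a + s * w| ^ (β - 2) * w) * w) s := fun s => by
    have := (((hasDerivAt_abs_rpow_mul_self (by linarith : 0 < β - 2) (a + s * w)).comp s
      (haff s)).const_mul β).mul_const w
    exact this.congr_deriv (by ring)
  have key := le_taylor_of_deriv_le_affine (M := β * (β - 1) * ((|a| + |w|) ^ (β - 2) * w ^ 2))
    (fun s _ => hF s) ?_
  · simp only [one_mul, zero_mul, add_zero] at key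
    linarith
  · intro s hs
    refine image_le_of_deriv_right_le_deriv_boundary
      (f := fun s : ℝ => β * (|a + s * w| ^ (β - 2) * (a + s * w)) * w)
      (fun s _ => (hG s).continuousAt.continuousWithinAt)
      (fun s _ => (hG s).hasDerivWithinAt)
      (B := fun s => β * (|a + 0 * w| ^ (β - 2) * (a + 0 * w)) * w
        + β * (β - 1) * ((|a| + |w|) ^ (β - 2) * w ^ 2) * s)
      (B' := fun _ => β * (β - 1) * ((|a| + |w|) ^ (β - 2) * w ^ 2))
      (by simp) (by fun_prop)
      (fun s _ => ?_) (fun r hr => ?_) hs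
    · have := ((hasDerivAt_id s).const_mul
        (β * (β - 1) * ((|a| + |w|) ^ (β - 2) * w ^ 2))).const_add
        (β * (|a + 0 * w| ^ (β - 2) * (a + 0 * w)) * w)
      simpa using this.hasDerivWithinAt
    · have h1 : |a + r * w| ≤ |a| + |w| := by
        refine (abs_add_le _ _).trans ?_
        rw [abs_mul, abs_of_nonneg hr.1]
        nlinarith [abs_nonneg w, hr.2]
      have h2 : |a + r * w| ^ (β - 2) ≤ (|a| + |w|) ^ (β - 2) :=
        Real.rpow_le_rpow (abs_nonneg _) h1 (by linarith)
      have h3 : 0 ≤ β * (β - 1) * w ^ 2 :=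
        mul_nonneg (mul_nonneg (by linarith) (by linarith)) (sq_nonneg w)
      nlinarith [mul_le_mul_of_nonneg_left h2 h3]

theorem add_rpow_le_weighted {p κ x y : ℝ} (hp : 0 ≤ p) (hκ : 0 < κ) (hx : 0 ≤ x) (hy : 0 ≤ y) :
    (x + y) ^ p ≤ (1 + κ) ^ p * x ^ p + (1 + κ⁻¹) ^ p * y ^ p := by
  have hκ' : 0 < κ⁻¹ := inv_pos.mpr hκ
  rw [← Real.mul_rpow (by positivity) hx, ← Real.mul_rpow (by positivity) hy]
  rcases le_total y (κ * x) with hyx | hyx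
  · have : (x + y) ^ p ≤ ((1 + κ) * x) ^ p :=
      Real.rpow_le_rpow (by positivity) (by linarith) hp
    have h2 : 0 ≤ ((1 + κ⁻¹) * y) ^ p := by positivity
    linarith
  · have hx' : x ≤ κ⁻¹ * y := by
      rw [inv_mul_eq_div, le_div_iff₀ hκ]; linarith
    have : (x + y) ^ p ≤ ((1 + κ⁻¹) * y) ^ p :=
      Real.rpow_le_rpow (by positivity) (by linarith) hp
    have h2 : 0 ≤ ((1 + κ) * x) ^ p := by positivity
    linarith

theorem rpow_sub_two_mul_sq_le {β η x y : ℝ} (hβ : 2 < β) (hη : 0 < η) (hx : 0 ≤ x) (hy : 0 ≤ y) :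
    x ^ (β - 2) * y ^ 2 ≤ η ^ 2 * x ^ β + (η⁻¹) ^ (β - 2) * y ^ β := by
  have hsplit : ∀ z : ℝ, 0 ≤ z → z ^ (β - 2) * z ^ 2 = z ^ β := fun z hz => by
    rw [← Real.rpow_natCast z 2, ← Real.rpow_add_of_nonneg hz (by linarith) (by norm_num)]
    norm_num
  have hη' : 0 < η⁻¹ := inv_pos.mpr hη
  rcases le_total y (η * x) with hyx | hyx
  · have : x ^ (β - 2) * y ^ 2 ≤ x ^ (β - 2) * (η * x) ^ 2 := by gcongr
    have h2 : 0 ≤ (η⁻¹) ^ (β - 2) * y ^ β := by positivity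
    rw [← hsplit x hx]
    linarith
  · have hx' : x ≤ η⁻¹ * y := by
      rw [inv_mul_eq_div, le_div_iff₀ hη]; linarith
    have : x ^ (β - 2) * y ^ 2 ≤ (η⁻¹ * y) ^ (β - 2) * y ^ 2 := by
      have := Real.rpow_le_rpow hx hx' (by linarith : 0 ≤ β - 2)
      gcongr
    rw [Real.mul_rpow hη'.le hy, mul_assoc, hsplit y hy] at this
    have h2 : 0 ≤ η ^ 2 * x ^ β := by positivity
    linarith

theorem remainder_weight_le {β κ t : ℝ} (hβ : 2 < β) (hκ : 0 < κ) (ht : 0 ≤ t) (a h v : ℝ) :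
    (|a| + t * |v|) ^ (β - 2) * v ^ 2 ≤
      (1 + κ) ^ (β - 2) * ((1 + κ) ^ 2 * (|a| ^ (β - 2) * h ^ 2) + (κ ^ 2 + κ) ^ 2 * |a| ^ β
        + (1 + κ⁻¹) ^ 2 * ((κ ^ 2)⁻¹) ^ (β - 2) * |v - h| ^ β)
      + (1 + κ⁻¹) ^ (β - 2) * t ^ (β - 2) * |v| ^ β := by
  have hsplit : |v| ^ (β - 2) * v ^ 2 = |v| ^ β := by
    rw [← sq_abs, ← Real.rpow_natCast |v| 2,
      ← Real.rpow_add_of_nonneg (abs_nonneg v) (by linarith) (by norm_num)]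
    norm_num
  have h1 := add_rpow_le_weighted (p := β - 2) (by linarith) hκ (abs_nonneg a)
    (mul_nonneg ht (abs_nonneg v))
  rw [Real.mul_rpow ht (abs_nonneg v)] at h1
  have h2 : v ^ 2 ≤ (1 + κ) ^ 2 * h ^ 2 + (1 + κ⁻¹) ^ 2 * |v - h| ^ 2 := by
    have := add_rpow_le_weighted (p := 2) (by norm_num) hκ (abs_nonneg h) (abs_nonneg (v - h))
    simp only [Real.rpow_two, sq_abs] at this
    rw [sq_abs]
    refine le_trans ?_ this
    rw [← sq_abs v]
    have h3 : |v| ≤ |h| + |v - h| := by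
      have := abs_add_le h (v - h)
      rwa [add_sub_cancel] at this
    gcongr
  have h3 := rpow_sub_two_mul_sq_le hβ (pow_pos hκ 2) (abs_nonneg a) (abs_nonneg (v - h))
  have hA : 0 ≤ |a| ^ (β - 2) := by positivity
  have hK : 0 ≤ (1 + κ) ^ (β - 2) := by positivity
  calc (|a| + t * |v|) ^ (β - 2) * v ^ 2
      ≤ ((1 + κ) ^ (β - 2) * |a| ^ (β - 2)
          + (1 + κ⁻¹) ^ (β - 2) * (t ^ (β - 2) * |v| ^ (β - 2))) * v ^ 2 := by gcongr
    _ = (1 + κ) ^ (β - 2) * (|a| ^ (β - 2) * v ^ 2)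
          + (1 + κ⁻¹) ^ (β - 2) * t ^ (β - 2) * |v| ^ β := by rw [← hsplit]; ring
    _ ≤ _ := by
      gcongr
      calc |a| ^ (β - 2) * v ^ 2
          ≤ |a| ^ (β - 2) * ((1 + κ) ^ 2 * h ^ 2 + (1 + κ⁻¹) ^ 2 * |v - h| ^ 2) := by gcongr
        _ = (1 + κ) ^ 2 * (|a| ^ (β - 2) * h ^ 2)
            + (1 + κ⁻¹) ^ 2 * (|a| ^ (β - 2) * |v - h| ^ 2) := by ring
        _ ≤ (1 + κ) ^ 2 * (|a| ^ (β - 2) * h ^ 2)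
            + (1 + κ⁻¹) ^ 2 * ((κ ^ 2) ^ 2 * |a| ^ β
              + ((κ ^ 2)⁻¹) ^ (β - 2) * |v - h| ^ β) := by gcongr
        _ = _ := by field_simp; ring

theorem integrable_abs_rpow_of_Lp {α : Type*} [MeasurableSpace α] {μ : Measure α} {β : ℝ}
    (hβ : 0 < β) (v : Lp ℝ (ENNReal.ofReal β) μ) : Integrable (fun x => |v x| ^ β) μ := by
  have := (Lp.memLp v).integrable_norm_rpow (by simpa using hβ) ENNReal.ofReal_ne_top
  simpa [ENNReal.toReal_ofReal hβ.le] using this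

theorem integral_abs_rpow_eq_norm_rpow {α : Type*} [MeasurableSpace α] {μ : Measure α} {β : ℝ}
    (hβ : 0 < β) (v : Lp ℝ (ENNReal.ofReal β) μ) : ∫ x, |v x| ^ β ∂μ = ‖v‖ ^ β := by
  rw [Lp.norm_def, (Lp.memLp v).eLpNorm_eq_integral_rpow_norm (by simpa using hβ)
    ENNReal.ofReal_ne_top]
  have h0 : 0 ≤ ∫ x, |v x| ^ β ∂μ := integral_nonneg fun x => by positivity
  simp only [ENNReal.toReal_ofReal hβ.le, Real.norm_eq_abs]
  rw [ENNReal.toReal_ofReal (by positivity), ← Real.rpow_mul h0, inv_mul_cancel₀ hβ.ne',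
    Real.rpow_one]

theorem integrable_abs_rpow_mul_sq {α : Type*} [MeasurableSpace α] {μ : Measure α} {β : ℝ}
    (hβ : 2 < β) (a v : Lp ℝ (ENNReal.ofReal β) μ) :
    Integrable (fun x => |a x| ^ (β - 2) * v x ^ 2) μ := by
  have ha := (Lp.aestronglyMeasurable a).aemeasurable
  have hv := (Lp.aestronglyMeasurable v).aemeasurable
  refine ((integrable_abs_rpow_of_Lp (by linarith) a).add
    (integrable_abs_rpow_of_Lp (by linarith) v)).mono'
    (((ha.abs.pow_const _).mul (hv.pow_const _)).aestronglyMeasurable)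
    (Filter.Eventually.of_forall fun x => ?_)
  have := rpow_sub_two_mul_sq_le hβ one_pos (abs_nonneg (a x)) (abs_nonneg (v x))
  rw [Real.norm_of_nonneg (by positivity)]
  simpa using this

theorem integrable_abs_rpow_mul_self_mul {α : Type*} [MeasurableSpace α] {μ : Measure α} {β : ℝ}
    (hβ : 2 < β) (a v : Lp ℝ (ENNReal.ofReal β) μ) :
    Integrable (fun x => |a x| ^ (β - 2) * a x * v x) μ := by
  have ha := (Lp.aestronglyMeasurable a).aemeasurable
  have hv := (Lp.aestronglyMeasurable v).aemeasurable
  refine ((integrable_abs_rpow_mul_sq hβ a a).add (integrable_abs_rpow_mul_sq hβ a v)).mono'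
    ((((ha.abs.pow_const _).mul ha).mul hv).aestronglyMeasurable)
    (Filter.Eventually.of_forall fun x => ?_)
  have hA : 0 ≤ |a x| ^ (β - 2) := by positivity
  have h1 : |a x| * |v x| ≤ a x ^ 2 + v x ^ 2 := by
    nlinarith [sq_nonneg (|a x| - |v x|), sq_abs (a x), sq_abs (v x)]
  simp only [norm_mul, Real.norm_eq_abs, abs_of_nonneg hA, Pi.add_apply]
  nlinarith [mul_le_mul_of_nonneg_left h1 hA]

theorem norm_add_smul_rpow_le {α : Type*} [MeasurableSpace α] {μ : Measure α} {β κ t : ℝ}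
    [Fact (1 ≤ ENNReal.ofReal β)] (hβ : 2 < β) (hκ : 0 < κ) (ht : 0 ≤ t)
    (a h v : Lp ℝ (ENNReal.ofReal β) μ) :
    ‖a + t • v‖ ^ β ≤ ‖a‖ ^ β + β * ∫ x, |a x| ^ (β - 2) * a x * (t • v) x ∂μ
      + β * (β - 1) / 2 * t ^ 2 *
        ((1 + κ) ^ (β - 2) * ((1 + κ) ^ 2 * (∫ x, |a x| ^ (β - 2) * h x ^ 2 ∂μ)
          + (κ ^ 2 + κ) ^ 2 * ‖a‖ ^ β
          + (1 + κ⁻¹) ^ 2 * ((κ ^ 2)⁻¹) ^ (β - 2) * ‖v - h‖ ^ β)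
        + (1 + κ⁻¹) ^ (β - 2) * t ^ (β - 2) * ‖v‖ ^ β) := by
  have hβ0 : 0 < β := by linarith
  have hI : ∀ w : Lp ℝ (ENNReal.ofReal β) μ, Integrable (fun x => |w x| ^ β) μ :=
    integrable_abs_rpow_of_Lp hβ0
  have i1 := (integrable_abs_rpow_mul_self_mul hβ a (t • v)).const_mul β
  have i2 := (integrable_abs_rpow_mul_sq hβ a h).const_mul ((1 + κ) ^ 2)
  have i3 := (hI a).const_mul ((κ ^ 2 + κ) ^ 2)
  have i4 := (hI (v - h)).const_mul ((1 + κ⁻¹) ^ 2 * ((κ ^ 2)⁻¹) ^ (β - 2))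
  have i5 := (hI v).const_mul ((1 + κ⁻¹) ^ (β - 2) * t ^ (β - 2))
  have i6 := ((i2.add i3).add i4).const_mul ((1 + κ) ^ (β - 2))
  have i7 := (i6.add i5).const_mul (β * (β - 1) / 2 * t ^ 2)
  have hmono := integral_mono_ae (hI (a + t • v)) (((hI a).add i1).add i7) ?_
  · rw [integral_add' ((hI a).add i1) i7, integral_add' (hI a) i1, integral_const_mul,
      integral_const_mul, integral_add' i6 i5, integral_const_mul, integral_const_mul,
      integral_add' (i2.add i3) i4, integral_add' i2 i3, integral_const_mul, integral_const_mul,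
      integral_const_mul] at hmono
    simpa only [integral_abs_rpow_eq_norm_rpow hβ0] using hmono
  · filter_upwards [Lp.coeFn_add a (t • v), Lp.coeFn_smul t v, Lp.coeFn_sub v h] with x hx1 hx2 hx3
    have h1 := abs_add_rpow_le_taylor hβ (a x) (t * v x)
    have h2 := remainder_weight_le hβ hκ ht (a x) (h x) (v x)
    rw [abs_mul, abs_of_nonneg ht] at h1
    have hc : 0 ≤ β * (β - 1) / 2 * t ^ 2 :=
      mul_nonneg (div_nonneg (mul_nonneg hβ0.le (by linarith)) (by norm_num)) (sq_nonneg t)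
    have h3 := mul_le_mul_of_nonneg_left h2 hc
    simp only [Pi.add_apply, hx1, hx2, hx3, Pi.smul_apply, Pi.sub_apply, smul_eq_mul]
    linarith

theorem HasFDerivAt.eventually_le_taylor {E : Type*} [NormedAddCommGroup E] [NormedSpace ℝ E]
    {f : E → ℝ} {f' : E → E →L[ℝ] ℝ} {f'' : E →L[ℝ] E →L[ℝ] ℝ} {a : E}
    (hf'' : HasFDerivAt f' f'' a) (hf' : ∀ u, HasFDerivAt f (f' u) u) {c : ℝ} (hc : 0 < c) :
    ∀ᶠ w in nhds (0 : E), f (a + w) ≤ f a + f' a w + (f'' w w + c * ‖w‖ ^ 2) / 2 := by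
  obtain ⟨δ, hδ, hb⟩ := Metric.eventually_nhds_iff.mp (hf''.isLittleO.def hc)
  filter_upwards [Metric.ball_mem_nhds (0 : E) hδ] with w hw
  have hw : ‖w‖ < δ := by simpa using hw
  have hline : ∀ s : ℝ, HasDerivAt (fun s : ℝ => a + s • w) w s := fun s => by
    simpa using ((hasDerivAt_id s).smul_const w).const_add a
  have key := le_taylor_of_deriv_le_affine (F := fun s : ℝ => f (a + s • w))
    (G := fun s => f' (a + s • w) w) (M := f'' w w + c * ‖w‖ ^ 2)
    (fun s _ => (hf' (a + s • w)).comp_hasDerivAt s (hline s)) ?_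
  · simpa using key
  · intro s hs
    have hsw : ‖s • w‖ = s * ‖w‖ := by rw [norm_smul, Real.norm_of_nonneg hs.1]
    have hb' := hb (y := a + s • w) (by
      rw [dist_eq_norm, add_sub_cancel_left, hsw]
      nlinarith [norm_nonneg w, hs.2])
    rw [add_sub_cancel_left, hsw] at hb'
    have h1 := (le_abs_self _).trans
      (((f' (a + s • w) - f' a - f'' (s • w)).le_opNorm w).trans
        (mul_le_mul_of_nonneg_right hb' (norm_nonneg w)))
    simp only [sub_apply, map_smul, smul_apply,
      smul_eq_mul] at h1
    simp only [zero_smul, add_zero]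
    linarith

/-- Second-order necessary optimality condition: if `ū ∈ U_ad` is a local minimizer of
`f` over `U_ad` (w.r.t. the `L^β` norm), `λ̄ ≥ 0` satisfies the complementarity and
stationarity conditions, and `h` lies in the approximating sequential tangent cone
`T(U_ad^λ, ū)`, then the second derivative of the Lagrangian at `(ū, λ̄)` in direction
`h` is nonnegative. -/
theorem second_order_necessary_condition
    {d : ℕ} (Ω : Set (Fin d → ℝ))
    (hΩbdd : Bornology.IsBounded Ω) (hΩmeas : MeasurableSet Ω)
    (hΩpos : 0 < volume Ω) (hΩfin : volume Ω < ⊤)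
    (μ : Measure (Fin d → ℝ)) (hμ : μ = volume.restrict Ω)
    (β b : ℝ) (hβ : 2 < β) (hb : 0 < b) [Fact (1 ≤ ENNReal.ofReal β)]
    (f : Lp ℝ (ENNReal.ofReal β) μ → ℝ)
    (f' : Lp ℝ (ENNReal.ofReal β) μ → (Lp ℝ (ENNReal.ofReal β) μ →L[ℝ] ℝ))
    (hf' : ∀ u : Lp ℝ (ENNReal.ofReal β) μ, HasFDerivAt f (f' u) u)
    (f''bar : Lp ℝ (ENNReal.ofReal β) μ →L[ℝ] (Lp ℝ (ENNReal.ofReal β) μ →L[ℝ] ℝ))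
    (ubar : Lp ℝ (ENNReal.ofReal β) μ)
    (hf'' : HasFDerivAt f' f''bar ubar)
    (hubar : (∫ x, |ubar x| ^ β ∂μ) ≤ b)
    -- ū is a local minimizer of f over U_ad w.r.t. the L^β norm
    (hmin : ∃ ε > (0 : ℝ), ∀ u : Lp ℝ (ENNReal.ofReal β) μ,
      (∫ x, |u x| ^ β ∂μ) ≤ b → ‖u - ubar‖ ≤ ε → f ubar ≤ f u)
    (lam : ℝ) (hlam : 0 ≤ lam)
    (hcomp : lam * (b - ∫ x, |ubar x| ^ β ∂μ) = 0)
    (hstat : ∀ h : Lp ℝ (ENNReal.ofReal β) μ,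
      f' ubar h - lam * (-(β * ∫ x, |ubar x| ^ (β - 2) * ubar x * h x ∂μ)) = 0)
    (h : Lp ℝ (ENNReal.ofReal β) μ)
    (u : ℕ → Lp ℝ (ENNReal.ofReal β) μ)
    (hu_ad : ∀ n : ℕ, (∫ x, |(u n) x| ^ β ∂μ) ≤ b)
    (hu_act : ∀ n : ℕ, lam * (b - ∫ x, |(u n) x| ^ β ∂μ) = 0)
    (t : ℕ → ℝ) (ht_pos : ∀ n : ℕ, 0 < t n)
    (ht_lim : Filter.Tendsto t Filter.atTop (nhds 0))
    (hconv : Filter.Tendsto (fun n : ℕ => (t n)⁻¹ • (u n - ubar))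
      Filter.atTop (nhds h)) :
    0 ≤ f''bar h h + lam * (β * (β - 1) * ∫ x, |ubar x| ^ (β - 2) * (h x) ^ 2 ∂μ) := by
  have hβ0 : 0 < β := by linarith
  simp only [integral_abs_rpow_eq_norm_rpow hβ0] at hubar hmin hcomp hu_ad hu_act
  obtain ⟨ε, hε, hmin⟩ := hmin
  set v : ℕ → Lp ℝ (ENNReal.ofReal β) μ := fun n => (t n)⁻¹ • (u n - ubar) with hv
  set I := ∫ x, |ubar x| ^ (β - 2) * (h x) ^ 2 ∂μ with hI
  have htv : ∀ n, t n • v n = u n - ubar := fun n => smul_inv_smul₀ (ht_pos n).ne' _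
  have hu : ∀ n, u n = ubar + t n • v n := fun n => by rw [htv, add_sub_cancel]
  have hstep : Filter.Tendsto (fun n => t n • v n) Filter.atTop (nhds 0) := by
    simpa using ht_lim.smul hconv
  have hnorm : Filter.Tendsto (fun n => ‖v n‖) Filter.atTop (nhds ‖h‖) := hconv.norm
  have hdiff : Filter.Tendsto (fun n => ‖v n - h‖ ^ β) Filter.atTop (nhds 0) := by
    have h1 : Filter.Tendsto (fun n => ‖v n - h‖) Filter.atTop (nhds 0) := by
      simpa using (hconv.sub_const h).norm
    simpa [Real.zero_rpow hβ0.ne'] using h1.rpow_const (Or.inr hβ0.le)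
  have htp : Filter.Tendsto (fun n => t n ^ (β - 2)) Filter.atTop (nhds 0) := by
    have hp : 0 < β - 2 := by linarith
    simpa [Real.zero_rpow hp.ne'] using ht_lim.rpow_const (Or.inr hp.le)
  have hquad : Filter.Tendsto (fun n => f''bar (v n) (v n)) Filter.atTop
      (nhds (f''bar h h)) := by
    have hc : Continuous fun w => f''bar w w := f''bar.continuous.clm_apply continuous_id
    exact (hc.tendsto h).comp hconv
  have hbound : ∀ κ : ℝ, 0 < κ → 0 ≤ f''bar h h + κ * ‖h‖ ^ 2 + lam * (β * (β - 1) *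
      ((1 + κ) ^ (β - 2) * ((1 + κ) ^ 2 * I + (κ ^ 2 + κ) ^ 2 * ‖ubar‖ ^ β))) := by
    intro κ hκ
    have hlim : Filter.Tendsto (fun n => f''bar (v n) (v n) + κ * ‖v n‖ ^ 2
        + lam * (β * (β - 1) * ((1 + κ) ^ (β - 2) * ((1 + κ) ^ 2 * I
          + (κ ^ 2 + κ) ^ 2 * ‖ubar‖ ^ β
          + (1 + κ⁻¹) ^ 2 * ((κ ^ 2)⁻¹) ^ (β - 2) * ‖v n - h‖ ^ β)
        + (1 + κ⁻¹) ^ (β - 2) * t n ^ (β - 2) * ‖v n‖ ^ β))) Filter.atTop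
        (nhds (f''bar h h + κ * ‖h‖ ^ 2
        + lam * (β * (β - 1) * ((1 + κ) ^ (β - 2) * ((1 + κ) ^ 2 * I
          + (κ ^ 2 + κ) ^ 2 * ‖ubar‖ ^ β
          + (1 + κ⁻¹) ^ 2 * ((κ ^ 2)⁻¹) ^ (β - 2) * 0)
        + (1 + κ⁻¹) ^ (β - 2) * 0 * ‖h‖ ^ β)))) :=
      (hquad.add ((hnorm.pow 2).const_mul κ)).add <| Filter.Tendsto.const_mul lam <|
        Filter.Tendsto.const_mul _ <|
          (((hdiff.const_mul _).const_add _).const_mul _).add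
            ((htp.const_mul _).mul (hnorm.rpow_const (Or.inr hβ0.le)))
    simp only [mul_zero, zero_mul, add_zero] at hlim
    refine ge_of_tendsto hlim ?_
    filter_upwards [hstep.eventually (hf''.eventually_le_taylor hf' hκ),
      hstep.eventually (Metric.closedBall_mem_nhds 0 hε)] with n hn1 hn2
    have hle : f ubar ≤ f (u n) := hmin (u n) (hu_ad n) (by
      rw [← htv]; simpa using hn2)
    rw [← hu] at hn1
    have hs := hstat (t n • v n)
    have hN := norm_add_smul_rpow_le hβ hκ (ht_pos n).le ubar h (v n)
    rw [← hu] at hN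
    have hact := hu_act n
    have hN' := mul_le_mul_of_nonneg_left hN hlam
    rw [norm_smul, Real.norm_of_nonneg (ht_pos n).le] at hn1
    simp only [map_smul f''bar, smul_apply,
      map_smul (f''bar (v n)), smul_eq_mul] at hn1
    have ht2 : 0 < t n ^ 2 / 2 := by have := ht_pos n; positivity
    refine nonneg_of_mul_nonneg_right (a := t n ^ 2 / 2) ?_ ht2
    linarith
  have hlim0 : Filter.Tendsto (fun κ : ℝ => f''bar h h + κ * ‖h‖ ^ 2 + lam * (β * (β - 1) *
      ((1 + κ) ^ (β - 2) * ((1 + κ) ^ 2 * I + (κ ^ 2 + κ) ^ 2 * ‖ubar‖ ^ β))))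
      (nhdsWithin 0 (Set.Ioi 0)) (nhds (f''bar h h + lam * (β * (β - 1) * I))) := by
    have hcont : Continuous (fun κ : ℝ => f''bar h h + κ * ‖h‖ ^ 2 + lam * (β * (β - 1) *
        ((1 + κ) ^ (β - 2) * ((1 + κ) ^ 2 * I + (κ ^ 2 + κ) ^ 2 * ‖ubar‖ ^ β)))) := by
      have : Continuous fun κ : ℝ => (1 + κ) ^ (β - 2) :=
        (continuous_const.add continuous_id).rpow_const fun _ => Or.inr (by linarith)
      fun_prop
    simpa using (hcont.tendsto 0).mono_left nhdsWithin_le_nhds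
  refine ge_of_tendsto hlim0 ?_
  filter_upwards [self_mem_nhdsWithin] with κ hκ using hbound κ hκ
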